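/- arXiv:1910.14214 — 4 statements merged into one kernel-verified Lean document; each statement's English description precedes it below -/
import Mathlib

section
/- Let V : [0,∞) → ℝ be a differentiable, nonnegative function and let a, b > 0, 0 < p < 1 and q > 1 be constants such that V'(t) ≤ -a·V(t)^p - b·V(t)^q for all t ≥ 0 (with the convention 0^p = 0^q = 0). Then V(t) = 0 for all t ≥ T, where T = 1/(a(1-p)) + 1/(b(q-1)). -/
/-- A positive solution of `V' ≤ -c V ^ m` with `m ≠ 1` satisfies the inequality obtained by
separating variables. -/
theorem rpow_div_sub_le_of_deriv_le {V V' : ℝ → ℝ} {c m s t : ℝ} (hm : m ≠ 1) (hst : s ≤ t)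
    (hpos : ∀ x ∈ Set.Icc s t, 0 < V x)
    (hderiv : ∀ x ∈ Set.Icc s t, HasDerivAt V (V' x) x)
    (hineq : ∀ x ∈ Set.Icc s t, V' x ≤ -c * V x ^ m) :
    V t ^ (1 - m) / (1 - m) - V s ^ (1 - m) / (1 - m) ≤ -c * (t - s) := by
  have hm' : 1 - m ≠ 0 := sub_ne_zero.mpr hm.symm
  have hd : ∀ x ∈ Set.Icc s t,
      HasDerivAt (fun y => V y ^ (1 - m) / (1 - m)) (V' x * V x ^ (-m)) x := by
    intro x hx
    have h := ((hderiv x hx).rpow_const (p := 1 - m) (Or.inl (hpos x hx).ne')).div_const (1 - m)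
    rwa [show 1 - m - 1 = -m by ring, mul_right_comm, mul_div_cancel_right₀ _ hm'] at h
  refine (convex_Icc s t).image_sub_le_mul_sub_of_deriv_le
    (fun x hx => (hd x hx).continuousAt.continuousWithinAt)
    (fun x hx => (hd x (interior_subset hx)).differentiableAt.differentiableWithinAt)
    (fun x hx => ?_) s (Set.left_mem_Icc.mpr hst) t (Set.right_mem_Icc.mpr hst) hst
  have hx := interior_subset hx
  rw [(hd x hx).deriv]
  calc V' x * V x ^ (-m) ≤ -c * V x ^ m * V x ^ (-m) :=
        mul_le_mul_of_nonneg_right (hineq x hx) (Real.rpow_nonneg (hpos x hx).le _)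
    _ = -c := by rw [mul_assoc, ← Real.rpow_add (hpos x hx), add_neg_cancel, Real.rpow_zero, mul_one]

/-- Fixed-time stability comparison lemma (Polyakov): if a nonnegative
differentiable function `V` satisfies `V' ≤ -a V^p - b V^q` with `a,b > 0`,
`0 < p < 1 < q`, then `V` vanishes after the fixed time
`T = 1/(a(1-p)) + 1/(b(q-1))`, independently of `V 0`. -/
theorem fixed_time_stability
    (V V' : ℝ → ℝ) (a b p q : ℝ)
    (ha : 0 < a) (hb : 0 < b) (hp0 : 0 < p) (hp1 : p < 1) (hq : 1 < q)
    (hVnonneg : ∀ t : ℝ, 0 ≤ t → 0 ≤ V t)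
    (hVderiv : ∀ t : ℝ, 0 ≤ t → HasDerivAt V (V' t) t)
    (hVineq : ∀ t : ℝ, 0 ≤ t → V' t ≤ -a * (V t) ^ p - b * (V t) ^ q) :
    ∀ t : ℝ, 1 / (a * (1 - p)) + 1 / (b * (q - 1)) ≤ t → V t = 0 := by
  intro t ht
  have hterm₁ : 0 < 1 / (a * (1 - p)) := one_div_pos.mpr (mul_pos ha (sub_pos.mpr hp1))
  have hterm₂ : 0 < 1 / (b * (q - 1)) := one_div_pos.mpr (mul_pos hb (sub_pos.mpr hq))
  set r := 1 / (b * (q - 1)) with hr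
  by_contra hne
  have ht0 : 0 ≤ t := by linarith
  have hVt : 0 < V t := (hVnonneg t ht0).lt_of_ne' hne
  have hanti : AntitoneOn V (Set.Ici 0) := by
    refine antitoneOn_of_hasDerivWithinAt_nonpos (f' := V') (convex_Ici 0)
      (fun x hx => (hVderiv x hx).continuousAt.continuousWithinAt)
      (fun x hx => (hVderiv x (interior_subset hx)).hasDerivWithinAt) (fun x hx => ?_)
    have hx : 0 ≤ x := interior_subset hx
    have := mul_nonneg ha.le (Real.rpow_nonneg (hVnonneg x hx) p)
    have := mul_nonneg hb.le (Real.rpow_nonneg (hVnonneg x hx) q)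
    linarith [hVineq x hx]
  have hpos : ∀ x, 0 ≤ x → x ≤ t → 0 < V x := fun x hx hxt => hVt.trans_le (hanti hx ht0 hxt)
  have hfar := rpow_div_sub_le_of_deriv_le (c := b) hq.ne' hterm₂.le
    (fun x hx => hpos x hx.1 (by linarith [hx.2])) (fun x hx => hVderiv x hx.1)
    (fun x hx => by
      have := mul_nonneg ha.le (Real.rpow_nonneg (hVnonneg x hx.1) p)
      linarith [hVineq x hx.1])
  have hnear := rpow_div_sub_le_of_deriv_le (c := a) hp1.ne (show r ≤ t by linarith)
    (fun x hx => hpos x (hterm₂.le.trans hx.1) hx.2)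
    (fun x hx => hVderiv x (hterm₂.le.trans hx.1))
    (fun x hx => by
      have hx0 := hterm₂.le.trans hx.1
      have := mul_nonneg hb.le (Real.rpow_nonneg (hVnonneg x hx0) q)
      linarith [hVineq x hx0])
  have hVr : 0 < V r := hpos r hterm₂.le (by linarith)
  have hVr_lt : V r < 1 := by
    by_contra! h
    have h1 : V r ^ (1 - q) ≤ 1 := Real.rpow_le_one_of_one_le_of_nonpos h (by linarith)
    have h0 : 0 < V 0 ^ (1 - q) := Real.rpow_pos_of_pos (hpos 0 le_rfl ht0) _
    have hbr : b * r = 1 / (q - 1) := by rw [hr]; field_simp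
    have hq' : 0 < q - 1 := sub_pos.mpr hq
    rw [← sub_div, sub_zero, neg_mul, hbr, ← neg_sub q 1, div_neg, neg_le_neg_iff,
      div_le_div_iff_of_pos_right hq'] at hfar
    rw [neg_sub] at hfar
    linarith
  have h1 : V r ^ (1 - p) < 1 := Real.rpow_lt_one hVr.le hVr_lt (by linarith)
  have h0 : 0 < V t ^ (1 - p) := Real.rpow_pos_of_pos hVt _
  have hp' : 0 < 1 - p := sub_pos.mpr hp1
  have hat : 1 / (1 - p) ≤ a * (t - r) := by
    calc 1 / (1 - p) = a * (1 / (a * (1 - p))) := by field_simp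
      _ ≤ a * (t - r) := mul_le_mul_of_nonneg_left (by linarith) ha.le
  have := div_lt_div_of_pos_right h1 hp'
  have := div_pos h0 hp'
  linarith
end

section
/- Fix N ∈ ℕ with N ≥ 1, constants α_1,…,α_N > 0, β_1,…,β_N ∈ ℝ, and exponents 0 < ν₁ < 1 and ν₂ > 1. Suppose P_i, λ_i : [0,∞) → ℝ are differentiable functions satisfying, for each i and all t ≥ 0, the coupled relation λ_i'(t)/(2α_i) = P_i'(t) + sgn^{ν₁}(e_i(t)) + sgn^{ν₂}(e_i(t)), where e_i(t) := P_i(t) − (λ_i(t) − β_i)/(2α_i). Then, setting T₁ = 2/(2^{(1+ν₁)/2}(1−ν₁)) + 2·N^{(ν₂−1)/2}/(2^{(1+ν₂)/2}(ν₂−1)), it holds that P_i(t) = (λ_i(t) − β_i)/(2α_i) for all t ≥ T₁ and all i ∈ {1,…,N}, regardless of the initial values P_i(0), λ_i(0). -/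
/-- `sgn^μ(x) = |x|^μ ⋅ sign x`. -/
noncomputable def sgnp (μ x : ℝ) : ℝ := |x| ^ μ * Real.sign x

theorem sgnp_mul_self {μ : ℝ} (hμ : 0 < μ) (x : ℝ) :
    sgnp μ x * x = (x ^ 2) ^ ((1 + μ) / 2) := by
  have hsign : Real.sign x * x = |x| := by
    rcases lt_trichotomy x 0 with h | h | h
    · rw [Real.sign_of_neg h, abs_of_neg h]; ring
    · simp [h]
    · rw [Real.sign_of_pos h, abs_of_pos h]; ring
  rw [sgnp, mul_assoc, hsign, ← sq_abs, ← Real.rpow_natCast, ← Real.rpow_mul (abs_nonneg x),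
    Nat.cast_ofNat, mul_div_cancel₀ _ two_ne_zero, add_comm 1 μ,
    Real.rpow_add_one' (abs_nonneg x) (by positivity)]

/-- A function with derivative at least `C` on an interval grows at rate at least `C`. -/
theorem mul_sub_le_sub_of_le_hasDerivAt {f f' : ℝ → ℝ} {C a b : ℝ} (hab : a ≤ b)
    (hf : ∀ t ∈ Set.Icc a b, HasDerivAt f (f' t) t) (hC : ∀ t ∈ Set.Icc a b, C ≤ f' t) :
    C * (b - a) ≤ f b - f a := by
  refine (convex_Icc a b).mul_sub_le_image_sub_of_le_deriv
    (fun t ht => (hf t ht).continuousAt.continuousWithinAt)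
    (fun t ht => (hf t (interior_subset ht)).differentiableAt.differentiableWithinAt)
    (fun t ht => ?_) a (Set.left_mem_Icc.2 hab) b (Set.right_mem_Icc.2 hab) hab
  rw [(hf t (interior_subset ht)).deriv]
  exact hC t (interior_subset ht)

/-- A positive solution of `v' = -2 (v ^ a + v ^ b)` with `a < 1 < b` lives for less than
`2 ^ (1 - a) / (2 * (1 - a)) + 2 ^ (1 - b) / (2 * (b - 1))`. -/
theorem lifespan_lt_of_hasDerivAt_rpow_add_rpow {v : ℝ → ℝ} {a b T : ℝ} (ha : a < 1) (hb : 1 < b)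
    (hT : 0 ≤ T) (hpos : ∀ t ∈ Set.Icc 0 T, 0 < v t)
    (hv : ∀ t ∈ Set.Icc 0 T, HasDerivAt v (-2 * (v t ^ a + v t ^ b)) t) :
    T < 2 ^ (1 - a) / (2 * (1 - a)) + 2 ^ (1 - b) / (2 * (b - 1)) := by
  have ha' : 0 < 2 * (1 - a) := by linarith
  have hb' : 0 < 2 * (b - 1) := by linarith
  have hmul : ∀ t ∈ Set.Icc 0 T, ∀ p q : ℝ, v t ^ p * v t ^ q = v t ^ (p + q) :=
    fun t ht p q => (Real.rpow_add (hpos t ht) p q).symm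
  by_contra! hle
  set τ : ℝ := 2 ^ (1 - b) / (2 * (b - 1)) with hτ
  have hτ0 : 0 ≤ τ := by positivity
  have hτT : τ ≤ T := le_trans (le_add_of_nonneg_left (by positivity)) hle
  have hτmem : τ ∈ Set.Icc 0 T := ⟨hτ0, hτT⟩
  have hvτ : v τ ≤ 2 := by
    have hgrow := mul_sub_le_sub_of_le_hasDerivAt (C := 2 * (b - 1)) hτ0
      (fun t ht => (hv t ⟨ht.1, ht.2.trans hτT⟩).rpow_const (p := 1 - b)
        (Or.inl (hpos t ⟨ht.1, ht.2.trans hτT⟩).ne'))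
      (fun t ht => by
        have ht' : t ∈ Set.Icc 0 T := ⟨ht.1, ht.2.trans hτT⟩
        have h1 := hmul t ht' a (1 - b - 1)
        have h2 := hmul t ht' b (1 - b - 1)
        rw [show b + (1 - b - 1) = 0 by ring, Real.rpow_zero] at h2
        have h3 := Real.rpow_pos_of_pos (hpos t ht') (a + (1 - b - 1))
        have h4 := mul_pos hb' h3
        linear_combination h4.le - 2 * (b - 1) * h1 - 2 * (b - 1) * h2)
    have h0 := Real.rpow_pos_of_pos (hpos 0 ⟨le_rfl, hT⟩) (1 - b)
    rw [sub_zero, hτ, mul_div_cancel₀ _ hb'.ne', ← hτ] at hgrow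
    by_contra! hlt
    linarith [Real.rpow_lt_rpow_of_neg two_pos hlt (show 1 - b < 0 by linarith)]
  have hdecay := mul_sub_le_sub_of_le_hasDerivAt (C := 2 * (1 - a)) hτT
    (fun t ht => ((hv t ⟨hτ0.trans ht.1, ht.2⟩).rpow_const (p := 1 - a)
      (Or.inl (hpos t ⟨hτ0.trans ht.1, ht.2⟩).ne')).fun_neg)
    (fun t ht => by
      have ht' : t ∈ Set.Icc 0 T := ⟨hτ0.trans ht.1, ht.2⟩
      have h1 := hmul t ht' a (1 - a - 1)
      have h2 := hmul t ht' b (1 - a - 1)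
      rw [show a + (1 - a - 1) = 0 by ring, Real.rpow_zero] at h1
      have h3 := Real.rpow_pos_of_pos (hpos t ht') (b + (1 - a - 1))
      have h4 := mul_pos ha' h3
      linear_combination h4.le - 2 * (1 - a) * h1 - 2 * (1 - a) * h2)
  have hend := Real.rpow_pos_of_pos (hpos T ⟨hT, le_rfl⟩) (1 - a)
  have hstart := Real.rpow_le_rpow (hpos τ hτmem).le hvτ (show 0 ≤ 1 - a by linarith)
  have hlen := (div_le_iff₀' ha').1 (le_sub_iff_add_le.2 hle)
  linarith

/-- Fixed-time stability of `e' = -sgn^{ν₁}(e) - sgn^{ν₂}(e)`. -/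
theorem eq_zero_of_hasDerivAt_neg_sgnp {e : ℝ → ℝ} {ν₁ ν₂ T : ℝ} (hν₁0 : 0 < ν₁) (hν₁1 : ν₁ < 1)
    (hν₂ : 1 < ν₂) (he : ∀ t, 0 ≤ t → HasDerivAt e (-sgnp ν₁ (e t) - sgnp ν₂ (e t)) t)
    (hT : 2 / (2 ^ ((1 + ν₁) / 2) * (1 - ν₁)) + 2 / (2 ^ ((1 + ν₂) / 2) * (ν₂ - 1)) ≤ T) :
    e T = 0 := by
  by_contra hne
  have hν₁' : 0 < 1 - ν₁ := by linarith
  have hν₂' : 0 < ν₂ - 1 := by linarith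
  have hT0 : 0 ≤ T := le_trans (by positivity) hT
  have hv : ∀ t, 0 ≤ t → HasDerivAt (fun s => e s ^ 2)
      (-2 * ((e t ^ 2) ^ ((1 + ν₁) / 2) + (e t ^ 2) ^ ((1 + ν₂) / 2))) t := fun t ht => by
    refine ((he t ht).fun_pow 2).congr_deriv ?_
    rw [← sgnp_mul_self hν₁0, ← sgnp_mul_self (by linarith)]
    push_cast
    ring
  have hpos : ∀ t ∈ Set.Icc 0 T, 0 < e t ^ 2 := fun t ht => by
    have hmono := mul_sub_le_sub_of_le_hasDerivAt (C := 0) ht.2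
      (fun s hs => (hv s (ht.1.trans hs.1)).fun_neg)
      (fun s hs => by
        have h1 := Real.rpow_nonneg (sq_nonneg (e s)) ((1 + ν₁) / 2)
        have h2 := Real.rpow_nonneg (sq_nonneg (e s)) ((1 + ν₂) / 2)
        linarith)
    have := sq_pos_of_ne_zero hne
    linarith
  have hlt := lifespan_lt_of_hasDerivAt_rpow_add_rpow (by linarith) (by linarith) hT0 hpos
    (fun t ht => hv t ht.1)
  rw [Real.rpow_sub two_pos, Real.rpow_sub two_pos, Real.rpow_one, div_div, div_div,
    show 2 * (1 - (1 + ν₁) / 2) = 1 - ν₁ by ring,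
    show 2 * ((1 + ν₂) / 2 - 1) = ν₂ - 1 by ring] at hlt
  linarith

/-- Theorem 1: under the coupled update law
`λᵢ'/(2αᵢ) = Pᵢ' + sgn^{ν₁}(eᵢ) + sgn^{ν₂}(eᵢ)` with `eᵢ = Pᵢ - (λᵢ-βᵢ)/(2αᵢ)`,
the relation `Pᵢ(t) = (λᵢ(t)-βᵢ)/(2αᵢ)` holds for all `t ≥ T₁`, where
`T₁ = 2/(2^{(1+ν₁)/2}(1-ν₁)) + 2 N^{(ν₂-1)/2}/(2^{(1+ν₂)/2}(ν₂-1))` is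
independent of the initial conditions. -/
theorem fixed_time_error_vanishing
    (N : ℕ) (hN : 1 ≤ N)
    (α β : Fin N → ℝ) (hα : ∀ i, 0 < α i)
    (ν₁ ν₂ : ℝ) (hν₁0 : 0 < ν₁) (hν₁1 : ν₁ < 1) (hν₂ : 1 < ν₂)
    (P P' lam lam' : Fin N → ℝ → ℝ)
    (hP : ∀ i, ∀ t : ℝ, 0 ≤ t → HasDerivAt (P i) (P' i t) t)
    (hlam : ∀ i, ∀ t : ℝ, 0 ≤ t → HasDerivAt (lam i) (lam' i t) t)
    (hdyn : ∀ i, ∀ t : ℝ, 0 ≤ t →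
      lam' i t / (2 * α i) =
        P' i t + sgnp ν₁ (P i t - (lam i t - β i) / (2 * α i))
               + sgnp ν₂ (P i t - (lam i t - β i) / (2 * α i))) :
    ∀ t : ℝ,
      2 / (2 ^ ((1 + ν₁) / 2) * (1 - ν₁))
        + 2 * (N : ℝ) ^ ((ν₂ - 1) / 2) / (2 ^ ((1 + ν₂) / 2) * (ν₂ - 1)) ≤ t →
      ∀ i, P i t = (lam i t - β i) / (2 * α i) := by
  intro t ht i
  have hν₂' : 0 < ν₂ - 1 := by linarith
  have hN1 : (1 : ℝ) ≤ (N : ℝ) ^ ((ν₂ - 1) / 2) :=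
    Real.one_le_rpow (by exact_mod_cast hN) (by positivity)
  refine sub_eq_zero.1 (eq_zero_of_hasDerivAt_neg_sgnp
    (e := fun s => P i s - (lam i s - β i) / (2 * α i)) hν₁0 hν₁1 hν₂ (fun s hs => ?_)
    (le_trans ?_ ht))
  · refine ((hP i s hs).fun_sub (((hlam i s hs).sub_const (β i)).div_const (2 * α i))).congr_deriv ?_
    rw [hdyn i s hs]
    ring
  · gcongr
    linarith
end

section
/- Let N ≥ 2, let a ∈ ℝ^{N×N} be symmetric with entries in {0,1}, let x ∈ ℝ^N, and let 0 < μ₁ < 1 and μ₂ > 1. Writing x_{ij} = x_i − x_j and S = ∑_{i,j=1}^N a_{ij} x_{ij}², it holds that (1/2) ∑_{i,j=1}^N a_{ij}·x_{ij}·(sign(x_{ji}) + sgn^{μ₁}(x_{ji}) + sgn^{μ₂}(x_{ji})) ≤ −(1/2)·S^{1/2} − (1/2)·S^{(1+μ₁)/2} − (1/(2N^{μ₂−1}))·S^{(1+μ₂)/2}. -/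
lemma rpow_sum_le_sum_rpow_of_le_one {ι : Type*} (s : Finset ι) {f : ι → ℝ} {p : ℝ}
    (hf : ∀ i ∈ s, 0 ≤ f i) (hp0 : 0 < p) (hp1 : p ≤ 1) :
    (∑ i ∈ s, f i) ^ p ≤ ∑ i ∈ s, f i ^ p :=
  Finset.le_sum_of_subadditive_on_pred (fun t : ℝ => t ^ p) (fun t => 0 ≤ t)
    (Real.zero_rpow hp0.ne').le
    (fun _ _ hx hy => Real.rpow_add_le_add_rpow hx hy hp0.le hp1)
    (fun _ _ hx hy => add_nonneg hx hy) f hf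

lemma mul_sgnp_neg {μ : ℝ} (hμ : 0 ≤ μ) (d : ℝ) : d * sgnp μ (-d) = -(d ^ 2) ^ ((1 + μ) / 2) := by
  have hsq : (d ^ 2) ^ ((1 + μ) / 2) = |d| * |d| ^ μ := by
    rw [← sq_abs, ← Real.rpow_natCast, ← Real.rpow_mul (abs_nonneg d), Nat.cast_ofNat,
      mul_div_cancel₀ _ two_ne_zero, Real.rpow_add_of_nonneg (abs_nonneg d) zero_le_one hμ,
      Real.rpow_one]
  rw [hsq, sgnp, abs_neg]
  rcases lt_trichotomy d 0 with h | rfl | h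
  · rw [Real.sign_of_pos (neg_pos.2 h), abs_of_neg h]; ring
  · simp
  · rw [Real.sign_of_neg (neg_neg_of_pos h), abs_of_pos h]; ring

lemma weighted_mul_sgnp {μ b : ℝ} (hμ : 0 ≤ μ) (hb : b = 0 ∨ b = 1) (u v : ℝ) :
    b * (u - v) * sgnp μ (v - u) = -(b * (u - v) ^ 2) ^ ((1 + μ) / 2) := by
  rcases hb with rfl | rfl
  · simp [Real.zero_rpow (by positivity : (1 + μ) / 2 ≠ 0)]
  · rw [one_mul, one_mul, ← neg_sub u v, mul_sgnp_neg hμ]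

/-- Inequality (13) in the proof of Theorem 2: with `x_{ij} = xᵢ - xⱼ` and
`S = ∑_{i,j} a_{ij} x_{ij}²`,
`(1/2)∑_{i,j} a_{ij} x_{ij} (sign(x_{ji}) + sgn^{μ₁}(x_{ji}) + sgn^{μ₂}(x_{ji}))
  ≤ -(1/2) S^{1/2} - (1/2) S^{(1+μ₁)/2} - (1/(2N^{μ₂-1})) S^{(1+μ₂)/2}`. -/
theorem consensus_term_inequality
    (N : ℕ) (hN : 2 ≤ N) (a : Fin N → Fin N → ℝ)
    (hsymm : ∀ i j, a i j = a j i) (h01 : ∀ i j, a i j = 0 ∨ a i j = 1)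
    (x : Fin N → ℝ)
    (μ₁ μ₂ : ℝ) (hμ₁0 : 0 < μ₁) (hμ₁1 : μ₁ < 1) (hμ₂ : 1 < μ₂) :
    (1 / 2) * ∑ i, ∑ j, a i j * (x i - x j) *
        (Real.sign (x j - x i) + sgnp μ₁ (x j - x i) + sgnp μ₂ (x j - x i))
    ≤ -(1 / 2) * (∑ i, ∑ j, a i j * (x i - x j) ^ 2) ^ ((1 : ℝ) / 2)
      - (1 / 2) * (∑ i, ∑ j, a i j * (x i - x j) ^ 2) ^ ((1 + μ₁) / 2)
      - (1 / (2 * (N : ℝ) ^ (μ₂ - 1)))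
          * (∑ i, ∑ j, a i j * (x i - x j) ^ 2) ^ ((1 + μ₂) / 2) := by
  set S := ∑ i, ∑ j, a i j * (x i - x j) ^ 2
  set f : Fin N × Fin N → ℝ := fun q => a q.1 q.2 * (x q.1 - x q.2) ^ 2
  have hf0 : ∀ q ∈ Finset.univ, 0 ≤ f q := fun q _ =>
    mul_nonneg (by rcases h01 q.1 q.2 with h | h <;> simp [h]) (sq_nonneg _)
  have hSf : S = ∑ q, f q := (Fintype.sum_prod_type f).symm
  have hlhs : ∑ i, ∑ j, a i j * (x i - x j) *
      (Real.sign (x j - x i) + sgnp μ₁ (x j - x i) + sgnp μ₂ (x j - x i))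
      = -(∑ q, f q ^ ((1 : ℝ) / 2) + ∑ q, f q ^ ((1 + μ₁) / 2)
        + ∑ q, f q ^ ((1 + μ₂) / 2)) := by
    rw [← Finset.sum_add_distrib, ← Finset.sum_add_distrib, ← Finset.sum_neg_distrib,
      Fintype.sum_prod_type]
    refine Finset.sum_congr rfl fun i _ => Finset.sum_congr rfl fun j _ => ?_
    have hsign : Real.sign (x j - x i) = sgnp 0 (x j - x i) := by simp [sgnp]
    rw [hsign, mul_add, mul_add, weighted_mul_sgnp le_rfl (h01 i j),
      weighted_mul_sgnp hμ₁0.le (h01 i j), weighted_mul_sgnp (by linarith) (h01 i j), add_zero]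
    ring
  have hhalf : S ^ ((1 : ℝ) / 2) ≤ ∑ q, f q ^ ((1 : ℝ) / 2) :=
    hSf ▸ rpow_sum_le_sum_rpow_of_le_one _ hf0 (by norm_num) (by norm_num)
  have hlow : S ^ ((1 + μ₁) / 2) ≤ ∑ q, f q ^ ((1 + μ₁) / 2) :=
    hSf ▸ rpow_sum_le_sum_rpow_of_le_one _ hf0 (by linarith) (by linarith)
  have hNpos : (0 : ℝ) < (N : ℝ) ^ (μ₂ - 1) :=
    Real.rpow_pos_of_pos (Nat.cast_pos.2 (by omega)) _
  have hhigh : S ^ ((1 + μ₂) / 2) ≤ (N : ℝ) ^ (μ₂ - 1) * ∑ q, f q ^ ((1 + μ₂) / 2) := by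
    have hmean := Real.rpow_sum_le_const_mul_sum_rpow_of_nonneg Finset.univ
      (p := (1 + μ₂) / 2) (by linarith) hf0
    have hcard : ((Finset.univ : Finset (Fin N × Fin N)).card : ℝ) ^ ((1 + μ₂) / 2 - 1)
        = (N : ℝ) ^ (μ₂ - 1) := by
      rw [Finset.card_univ, Fintype.card_prod, Fintype.card_fin, ← sq, Nat.cast_pow,
        ← Real.rpow_natCast, ← Real.rpow_mul (Nat.cast_nonneg N)]
      congr 1
      push_cast
      ring
    rwa [hcard, ← hSf] at hmean
  have hscaled : 1 / (2 * (N : ℝ) ^ (μ₂ - 1)) * S ^ ((1 + μ₂) / 2)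
      ≤ 1 / 2 * ∑ q, f q ^ ((1 + μ₂) / 2) := by
    rw [one_div_mul_eq_div, div_le_iff₀ (by positivity)]
    linarith
  rw [hlhs]
  linarith
end

section
/- Let h > 0 and let z : ℕ → ℝ satisfy the recursion z(k+1) = z(k)/(1 + h·|z(k)|) for all k ≥ 0. Then for every k ≥ 1, |z(k)| ≤ 1/(k·h), independently of the initial value z(0). Consequently, for every ε > 0 there exists N_ε ∈ ℕ (namely any N_ε ≥ 1/(h·ε)) such that |z(k)| ≤ ε for all k ≥ N_ε, uniformly over all initial conditions z(0) ∈ ℝ. -/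
/-- The map `a ↦ a / (1 + h|a|)` shifts `1 / (h|a|)` by one, so `k h |z k| ≤ 1` along orbits. -/
lemma mul_abs_le_one_of_semiImplicitEuler {h : ℝ} (hh : 0 < h) {z : ℕ → ℝ}
    (hrec : ∀ k : ℕ, z (k + 1) = z k / (1 + h * |z k|)) (k : ℕ) :
    k * h * |z k| ≤ 1 := by
  induction k with
  | zero => simp
  | succ k ih =>
    have hpos : 0 < 1 + h * |z k| := by positivity
    rw [hrec, abs_div, abs_of_pos hpos, ← mul_div_assoc, div_le_one hpos]
    push_cast
    linarith

/-- Practical fixed-time stability of the semi-implicit Euler discretization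
`z(k+1) = z(k)/(1 + h|z(k)|)` of `ż = -|z|z`: `|z(k)| ≤ 1/(k h)` for `k ≥ 1`
independently of `z(0)`; hence for every `ε > 0`, `|z(k)| ≤ ε` for all
`k ≥ N_ε` with `N_ε` independent of the initial condition. -/
theorem discrete_practical_fixed_time
    (h : ℝ) (hh : 0 < h) (z : ℕ → ℝ)
    (hrec : ∀ k : ℕ, z (k + 1) = z k / (1 + h * |z k|)) :
    (∀ k : ℕ, 1 ≤ k → |z k| ≤ 1 / (k * h)) ∧
    (∀ ε : ℝ, 0 < ε → ∀ Nε : ℕ, 1 / (h * ε) ≤ Nε →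
      ∀ k : ℕ, Nε ≤ k → |z k| ≤ ε) := by
  have hbound := mul_abs_le_one_of_semiImplicitEuler hh hrec
  refine ⟨fun k hk => ?_, fun ε hε N hN k hk => ?_⟩
  · have hk' : (0 : ℝ) < k := by exact_mod_cast hk
    rw [le_div_iff₀' (by positivity)]
    exact hbound k
  · have hNk : 1 / (h * ε) ≤ (k : ℝ) := hN.trans (by exact_mod_cast hk)
    have hk' : (0 : ℝ) < k := lt_of_lt_of_le (by positivity) hNk
    rw [div_le_iff₀ (by positivity), ← mul_assoc] at hNk
    exact le_of_mul_le_mul_left ((hbound k).trans hNk) (by positivity)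
end
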